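/- arXiv:alg-geom/9604005 — 3 statements merged into one kernel-verified Lean document; each statement's English description precedes it below -/
import Mathlib

section
/- Let V and W be modules over the quaternions ℍ = Quaternion ℝ. Suppose B : V → V → W is symmetric (B x y = B y x for all x, y ∈ V) and quaternion-homogeneous in its first argument, i.e. B (q • x) y = q • B x y for all q ∈ ℍ and x, y ∈ V. Then B is identically zero: B x y = 0 for all x, y ∈ V. -/
/-- A symmetric bilinear-type map `B : V → V → W` between modules over the
real quaternions which is quaternion-homogeneous in its first argument must vanish
identically.  This is the algebraic content of the paper's lemma that the second fundamental
form of a quaternionic submanifold of a quaternionic vector space vanishes. -/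
theorem symm_quaternion_homogeneous_eq_zero
    {V W : Type*} [AddCommGroup V] [AddCommGroup W]
    [Module (Quaternion ℝ) V] [Module (Quaternion ℝ) W]
    (B : V → V → W)
    (hsymm : ∀ x y : V, B x y = B y x)
    (hhom : ∀ (q : Quaternion ℝ) (x y : V), B (q • x) y = q • B x y) :
    ∀ x y : V, B x y = 0 := by
  intro x y
  have hr : ∀ (q : Quaternion ℝ) (x y : V), B x (q • y) = q • B x y := by
    intro q x y
    rw [hsymm, hhom, hsymm]
  have key : ∀ p q : Quaternion ℝ, (p * q - q * p) • B x y = 0 := by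
    intro p q
    have h : p • q • B x y = q • p • B x y := by
      rw [← hr q x y, ← hhom p, hr, hhom]
    rw [sub_smul, mul_smul, mul_smul, h, sub_self]
  have h := key ⟨0, 1, 0, 0⟩ ⟨0, 0, 1, 0⟩
  refine (smul_eq_zero.mp h).resolve_left ?_
  intro h0
  have h1 := congrArg (fun q : Quaternion ℝ => q.imK) h0
  beta_reduce at h1
  erw [Quaternion.imK_sub, Quaternion.imK_mul, Quaternion.imK_mul, Quaternion.imK_zero] at h1
  norm_num at h1
end

section
/- Let E and F be normed real vector spaces each equipped with a module structure over ℍ = Quaternion ℝ compatible with the real scalar action (so r • v for r : ℝ agrees with the action of r viewed in ℍ), and such that for each fixed q ∈ ℍ the map v ↦ q • v is continuous on E and on F. Let U ⊆ E be open and let f : E → F be twice continuously differentiable on U (ContDiffOn ℝ 2 f U). Assume that for every x ∈ U the Fréchet derivative of f at x is quaternion-linear, i.e. fderiv ℝ f x (q • v) = q • (fderiv ℝ f x v) for all q ∈ ℍ and v ∈ E. Then the second derivative of f vanishes on U: iteratedFDeriv ℝ 2 f x = 0 for every x ∈ U. -/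
/-- If `f` is `C²` on an open set `U` of a normed real vector space `E`
carrying a compatible quaternionic module structure (with continuous quaternion action),
with values in another such space `F`, and the Fréchet derivative of `f` is
quaternion-linear at every point of `U`, then the second derivative of `f` vanishes on `U`.
This is the analytic form of the paper's lemma that a locally defined smooth quaternionic
subvariety of a quaternionic vector space is flat. -/
theorem quaternionic_c2_map_second_derivative_zero
    {E F : Type*}
    [NormedAddCommGroup E] [NormedSpace ℝ E]
    [NormedAddCommGroup F] [NormedSpace ℝ F]
    [Module (Quaternion ℝ) E] [IsScalarTower ℝ (Quaternion ℝ) E]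
    [Module (Quaternion ℝ) F] [IsScalarTower ℝ (Quaternion ℝ) F]
    (hE : ∀ q : Quaternion ℝ, Continuous fun v : E => q • v)
    (hF : ∀ q : Quaternion ℝ, Continuous fun w : F => q • w)
    {U : Set E} (hU : IsOpen U) {f : E → F}
    (hf : ContDiffOn ℝ 2 f U)
    (hlin : ∀ x ∈ U, ∀ (q : Quaternion ℝ) (v : E),
      fderiv ℝ f x (q • v) = q • fderiv ℝ f x v) :
    ∀ x ∈ U, iteratedFDeriv ℝ 2 f x = 0 := by
  intro x hx
  have hfx : ContDiffAt ℝ 2 f x := hf.contDiffAt (hU.mem_nhds hx)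
  have hsymm : IsSymmSndFDerivAt ℝ f x := hfx.isSymmSndFDerivAt (by simp)
  have hd : DifferentiableAt ℝ (fderiv ℝ f) x :=
    (hfx.fderiv_right (m := 1) (by norm_num)).differentiableAt (by norm_num)
  have hB : ∀ (q : Quaternion ℝ) (u v : E),
      fderiv ℝ (fderiv ℝ f) x u (q • v) = q • fderiv ℝ (fderiv ℝ f) x u v := by
    intro q u v
    have hcomm : ∀ (r : ℝ) (w : F), q • (r • w) = r • (q • w) := by
      intro r w
      have hs : ∀ w : F, r • w = (r • (1 : Quaternion ℝ)) • w := by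
        intro w
        rw [smul_assoc, one_smul]
      rw [hs w, hs (q • w), smul_smul, smul_smul, mul_smul_comm, smul_mul_assoc, mul_one, one_mul]
    let L : F →L[ℝ] F :=
      { toFun := fun w => q • w
        map_add' := fun a b => smul_add q a b
        map_smul' := fun r w => hcomm r w
        cont := hF q }
    have h1 : HasFDerivAt (fun y => fderiv ℝ f y (q • v))
        ((fderiv ℝ (fderiv ℝ f) x).flip (q • v)) x := by
      simpa using hd.hasFDerivAt.clm_apply (hasFDerivAt_const (q • v) x)
    have h2 : HasFDerivAt (fun y => fderiv ℝ f y v)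
        ((fderiv ℝ (fderiv ℝ f) x).flip v) x := by
      simpa using hd.hasFDerivAt.clm_apply (hasFDerivAt_const v x)
    have h3 := L.hasFDerivAt.comp x h2
    have h4 : (fun y => fderiv ℝ f y (q • v)) =ᶠ[nhds x] (L ∘ fun y => fderiv ℝ f y v) := by
      filter_upwards [hU.mem_nhds hx] with y hy using hlin y hy q v
    have h5 := h1.unique (h3.congr_of_eventuallyEq h4)
    exact congrArg (fun T : E →L[ℝ] F => T u) h5
  have hB' : ∀ (q : Quaternion ℝ) (u v : E),
      fderiv ℝ (fderiv ℝ f) x (q • u) v = q • fderiv ℝ (fderiv ℝ f) x u v := by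
    intro q u v
    rw [hsymm.eq, hB, hsymm.eq]
  have hzero : ∀ u v : E, fderiv ℝ (fderiv ℝ f) x u v = 0 := by
    intro u v
    let i : Quaternion ℝ := ⟨0, 1, 0, 0⟩
    let j : Quaternion ℝ := ⟨0, 0, 1, 0⟩
    have h : (i * j) • fderiv ℝ (fderiv ℝ f) x u v
        = (j * i) • fderiv ℝ (fderiv ℝ f) x u v := by
      rw [mul_smul, mul_smul, ← hB j, ← hB' i, hB, hB']
    have hne : i * j - j * i ≠ 0 := by
      intro h0
      have := congrArg (fun q : Quaternion ℝ => q.imK) h0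
      have e : (i * j - j * i).imK = (0 : Quaternion ℝ).imK := this
      rw [Quaternion.imK_sub, Quaternion.imK_mul, Quaternion.imK_mul, Quaternion.imK_zero] at e
      norm_num [i, j] at e
    rw [← sub_eq_zero, ← sub_smul] at h
    exact (smul_eq_zero.mp h).resolve_left hne
  ext m
  rw [iteratedFDeriv_two_apply]
  simpa using hzero (m 0) (m 1)
end

section
/- In the quaternions ℍ = Quaternion ℝ, for all real numbers u, v, the element q = 1 - u•k + v•j is invertible, and conjugation by q sends i to the point of the unit sphere given by stereographic projection of u + iv: q⁻¹ * i * q = x•i + y•j + z•k, where x = (1 - u² - v²)/(1 + u² + v²), y = 2u/(1 + u² + v²), and z = 2v/(1 + u² + v²). -/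
/-- The quaternion unit `i`. -/
def quatI : Quaternion ℝ := ⟨0, 1, 0, 0⟩

/-- The quaternion unit `j`. -/
def quatJ : Quaternion ℝ := ⟨0, 0, 1, 0⟩

/-- The quaternion unit `k`. -/
def quatK : Quaternion ℝ := ⟨0, 0, 0, 1⟩

theorem quatI_re : quatI.re = 0 := rfl
theorem quatI_imI : quatI.imI = 1 := rfl
theorem quatI_imJ : quatI.imJ = 0 := rfl
theorem quatI_imK : quatI.imK = 0 := rfl
theorem quatJ_re : quatJ.re = 0 := rfl
theorem quatJ_imI : quatJ.imI = 0 := rfl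
theorem quatJ_imJ : quatJ.imJ = 1 := rfl
theorem quatJ_imK : quatJ.imK = 0 := rfl
theorem quatK_re : quatK.re = 0 := rfl
theorem quatK_imI : quatK.imI = 0 := rfl
theorem quatK_imJ : quatK.imJ = 0 := rfl
theorem quatK_imK : quatK.imK = 1 := rfl

theorem qone_re : (1 : Quaternion ℝ).re = 1 := rfl
theorem qone_imI : (1 : Quaternion ℝ).imI = 0 := rfl
theorem qone_imJ : (1 : Quaternion ℝ).imJ = 0 := rfl
theorem qone_imK : (1 : Quaternion ℝ).imK = 0 := rfl
theorem qzero_re : (0 : Quaternion ℝ).re = 0 := rfl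

/-- In the quaternions, for all real `u, v` the element
`q = 1 - u•k + v•j` is invertible and conjugation by `q` sends `i` to the point
`x•i + y•j + z•k` of the unit sphere corresponding to `λ = u + iv` under stereographic
projection: `x = (1 - u² - v²)/(1 + u² + v²)`, `y = 2u/(1 + u² + v²)`,
`z = 2v/(1 + u² + v²)`.  This is the paper's twistor-space formula
`I_{u+iv} = (1 - uK + vJ)⁻¹ I (1 - uK + vJ)`. -/
theorem twistor_conjugation_formula (u v : ℝ) :
    IsUnit (1 - u • quatK + v • quatJ) ∧
      (1 - u • quatK + v • quatJ)⁻¹ * quatI * (1 - u • quatK + v • quatJ) =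
        ((1 - u ^ 2 - v ^ 2) / (1 + u ^ 2 + v ^ 2)) • quatI +
          (2 * u / (1 + u ^ 2 + v ^ 2)) • quatJ +
          (2 * v / (1 + u ^ 2 + v ^ 2)) • quatK := by
  have hN : (1 + u ^ 2 + v ^ 2 : ℝ) ≠ 0 := by positivity
  have hq : (1 - u • quatK + v • quatJ) ≠ 0 := by
    intro h
    have h1 := congrArg (fun q : Quaternion ℝ => q.re) h
    simp [quatK_re, quatJ_re, qone_re, qzero_re] at h1
  refine ⟨isUnit_iff_ne_zero.mpr hq, ?_⟩
  rw [mul_assoc, inv_mul_eq_iff_eq_mul₀ hq]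
  ext <;> simp [qone_re, qone_imI, qone_imJ, qone_imK, quatI_re, quatI_imI, quatI_imJ, quatI_imK, quatJ_re, quatJ_imI, quatJ_imJ, quatJ_imK, quatK_re, quatK_imI, quatK_imJ, quatK_imK] <;>
     field_simp <;> ring
end
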